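/- arXiv:2512.13810 — 14 statements merged into one kernel-verified Lean document; each statement's English description precedes it below -/
import Mathlib

section
/- Fix real numbers μ0 > 0, K > 1, and an arrival rate λ with 0 < λ < (K+1)·μ0. Then the tunable-mode delay function f ↦ T_TM(f;λ) is strictly convex on the open interval (1 − K·μ0/λ, μ0/λ), and f_min(λ) := (λ − μ0·(K − √K))/(λ·(1 + √K)) lies in this interval and is the unique minimizer of T_TM(·;λ) over this interval. -/
/-- The strict Jensen inequality for the reciprocal on the positive reals. -/
lemma inv_convex_combination_lt {u w α β : ℝ} (hu : 0 < u) (hw : 0 < w) (huw : u ≠ w)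
    (hα : 0 < α) (hβ : 0 < β) (hαβ : α + β = 1) :
    (α * u + β * w)⁻¹ < α * u⁻¹ + β * w⁻¹ := by
  simpa using (strictConvexOn_zpow (m := -1) (by norm_num) (by norm_num)).2
    (Set.mem_Ioi.2 hu) (Set.mem_Ioi.2 hw) huw hα hβ hαβ

/-- The delay of a server with capacity `a` under load share `x`, written through the
reciprocal of its spare capacity. -/
lemma div_sub_mul_eq_inv {a x l : ℝ} (hl : l ≠ 0) (h : a - x * l ≠ 0) :
    x / (a - x * l) = a / l * (a - x * l)⁻¹ - 1 / l := by
  field_simp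
  ring

/-- The delay of a single server is strictly convex in its load share. -/
lemma strictConvexOn_div_sub_mul {a l : ℝ} (ha : 0 < a) (hl : 0 < l) {s : Set ℝ}
    (hs : Convex ℝ s) (hpos : ∀ x ∈ s, 0 < a - x * l) :
    StrictConvexOn ℝ s fun x => x / (a - x * l) := by
  refine ⟨hs, fun x hx y hy hxy α β hα hβ hαβ => ?_⟩
  have hz := hpos _ (hs hx hy hα.le hβ.le hαβ)
  have hne : a - x * l ≠ a - y * l := fun h =>
    hxy (mul_right_cancel₀ hl.ne' (sub_right_injective h))
  have hinv := inv_convex_combination_lt (hpos x hx) (hpos y hy) hne hα hβ hαβ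
  simp only [smul_eq_mul] at hz ⊢
  have harg : α * (a - x * l) + β * (a - y * l) = a - (α * x + β * y) * l := by
    linear_combination a * hαβ
  rw [harg] at hinv
  rw [div_sub_mul_eq_inv hl.ne' hz.ne', div_sub_mul_eq_inv hl.ne' (hpos x hx).ne',
    div_sub_mul_eq_inv hl.ne' (hpos y hy).ne']
  have hmul := mul_lt_mul_of_pos_left hinv (div_pos ha hl)
  linear_combination hmul + 1 / l * hαβ

/-- A weighted Cauchy-Schwarz (Sedrakyan) inequality, strict off the equality case. -/
lemma one_add_sq_div_add_lt {s u v : ℝ} (hu : 0 < u) (hv : 0 < v) (hne : v ≠ s * u) :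
    (1 + s) ^ 2 / (u + v) < u⁻¹ + s ^ 2 * v⁻¹ := by
  have hdiff : u⁻¹ + s ^ 2 * v⁻¹ - (1 + s) ^ 2 / (u + v) =
      (v - s * u) ^ 2 / (u * v * (u + v)) := by
    field_simp
    ring
  have hsq : 0 < (v - s * u) ^ 2 := by
    have := sub_ne_zero.2 hne
    positivity
  have : 0 < (v - s * u) ^ 2 / (u * v * (u + v)) := by positivity
  linarith


/-- The tunable-mode delay function is strictly convex on
`(1 - K·μ0/λ, μ0/λ)`, and `f_min(λ)` lies in this interval and is its unique
minimizer there. -/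
theorem tunable_mode_strict_convex_unique_minimizer
    (μ0 K lam : ℝ) (hμ0 : 0 < μ0) (hK : 1 < K)
    (hlam0 : 0 < lam) (hlam : lam < (K + 1) * μ0)
    (T : ℝ → ℝ)
    (hT : T = fun f => f / (μ0 - f * lam) + (1 - f) / (K * μ0 - (1 - f) * lam))
    (fmin : ℝ)
    (hfmin : fmin = (lam - μ0 * (K - Real.sqrt K)) / (lam * (1 + Real.sqrt K))) :
    StrictConvexOn ℝ (Set.Ioo (1 - K * μ0 / lam) (μ0 / lam)) T ∧
    fmin ∈ Set.Ioo (1 - K * μ0 / lam) (μ0 / lam) ∧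
    (∀ f ∈ Set.Ioo (1 - K * μ0 / lam) (μ0 / lam), f ≠ fmin → T fmin < T f) := by
  subst hT
  obtain ⟨s, hs0, hs1, rfl⟩ : ∃ s : ℝ, 0 < s ∧ Real.sqrt K = s ∧ K = s ^ 2 :=
    ⟨Real.sqrt K, Real.sqrt_pos.2 (by linarith), rfl, (Real.sq_sqrt (by linarith)).symm⟩
  rw [hs1] at hfmin
  have hc : 0 < s ^ 2 * μ0 := by positivity
  have hmem : ∀ f, f ∈ Set.Ioo (1 - s ^ 2 * μ0 / lam) (μ0 / lam) ↔
      0 < s ^ 2 * μ0 - (1 - f) * lam ∧ 0 < μ0 - f * lam := by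
    intro f
    rw [Set.mem_Ioo, sub_lt_comm, lt_div_iff₀ hlam0, lt_div_iff₀ hlam0, sub_pos, sub_pos]
  have hS : 0 < (s ^ 2 + 1) * μ0 - lam := sub_pos.2 hlam
  have humin : μ0 - fmin * lam = ((s ^ 2 + 1) * μ0 - lam) / (1 + s) := by
    rw [hfmin]
    field_simp
    ring
  have hvmin : s ^ 2 * μ0 - (1 - fmin) * lam =
      s * (((s ^ 2 + 1) * μ0 - lam) / (1 + s)) := by
    rw [hfmin]
    field_simp
    ring
  have hfmem : fmin ∈ Set.Ioo (1 - s ^ 2 * μ0 / lam) (μ0 / lam) := by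
    rw [hmem, humin, hvmin]
    constructor <;> positivity
  refine ⟨?_, hfmem, fun f hf hne => ?_⟩
  · refine (strictConvexOn_div_sub_mul hμ0 hlam0 (convex_Ioo _ _)
      fun x hx => ((hmem x).1 hx).2).add ⟨convex_Ioo _ _, fun x hx y hy hxy α β hα hβ hαβ => ?_⟩
    have hconv := strictConvexOn_div_sub_mul hc hlam0
      (s := {z | 0 < s ^ 2 * μ0 - z * lam})
      (by
        intro z hz w hw a b ha hb hab
        simp only [Set.mem_ofPred_eq, smul_eq_mul] at hz hw ⊢
        have harg : s ^ 2 * μ0 - (a * z + b * w) * lam =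
            a * (s ^ 2 * μ0 - z * lam) + b * (s ^ 2 * μ0 - w * lam) := by
          linear_combination -(s ^ 2 * μ0) * hab
        rw [harg]
        exact (convex_Ioi (0 : ℝ)) hz hw ha hb hab)
      fun _ hz => hz
    have hlt := hconv.2 ((hmem x).1 hx).1 ((hmem y).1 hy).1
      (fun h => hxy (sub_right_injective h)) hα hβ hαβ
    have harg : α • (1 - x) + β • (1 - y) = 1 - (α • x + β • y) := by
      simp only [smul_eq_mul]
      linear_combination hαβ
    rwa [harg] at hlt
  · obtain ⟨hv, hu⟩ := (hmem f).1 hf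
    obtain ⟨hv', hu'⟩ := (hmem fmin).1 hfmem
    have hoff : s ^ 2 * μ0 - (1 - f) * lam ≠ s * (μ0 - f * lam) := by
      intro h
      apply hne
      rw [hfmin, eq_div_iff (by positivity)]
      linear_combination h
    have hlt := one_add_sq_div_add_lt hu hv hoff
    have hsum : μ0 - f * lam + (s ^ 2 * μ0 - (1 - f) * lam) = (s ^ 2 + 1) * μ0 - lam := by
      ring
    rw [hsum] at hlt
    have heq : (1 + s) ^ 2 / ((s ^ 2 + 1) * μ0 - lam) =
        (μ0 - fmin * lam)⁻¹ + s ^ 2 * (s ^ 2 * μ0 - (1 - fmin) * lam)⁻¹ := by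
      rw [humin, hvmin]
      field_simp
    rw [heq] at hlt
    dsimp only
    rw [div_sub_mul_eq_inv hlam0.ne' hu.ne', div_sub_mul_eq_inv hlam0.ne' hv.ne',
      div_sub_mul_eq_inv hlam0.ne' hu'.ne', div_sub_mul_eq_inv hlam0.ne' hv'.ne']
    have hmul := mul_lt_mul_of_pos_left hlt (div_pos hμ0 hlam0)
    linear_combination hmul
end

section
/- Fix real numbers μ0 > 0, K > 1, and an arrival rate λ with 0 < λ < (K+1)·μ0. Then f*(λ) := max{f_min(λ), 0} belongs to the feasible set F_λ := [0,1] ∩ (1 − K·μ0/λ, μ0/λ), minimizes T_TM(·;λ) over F_λ (i.e. T_TM(f*(λ);λ) ≤ T_TM(f;λ) for all f ∈ F_λ), and the minimum value satisfies: T_TM(f*(λ);λ) = (2λ − (√K − 1)²·μ0)/(λ·((K+1)·μ0 − λ)) if λ > (K − √K)·μ0, and T_TM(f*(λ);λ) = 1/(K·μ0 − λ) if λ ≤ (K − √K)·μ0. -/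
/-- A weighted sum of two inverses is
bounded below by the Cauchy–Schwarz inequality. -/
lemma one_add_sq_div_add_le {a b : ℝ} (s : ℝ) (ha : 0 < a) (hb : 0 < b) :
    (1 + s) ^ 2 / (a + b) ≤ 1 / a + s ^ 2 / b := by
  rw [div_add_div _ _ ha.ne' hb.ne', div_le_div_iff₀ (by positivity) (by positivity)]
  nlinarith [sq_nonneg (b - s * a)]

/-- The delay expressed through the residual capacities of the two modes. -/
lemma delay_eq_residual {m M l f : ℝ} (hl : l ≠ 0) (ha : m - f * l ≠ 0)
    (hb : M - (1 - f) * l ≠ 0) :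
    f / (m - f * l) + (1 - f) / (M - (1 - f) * l) =
      (m / (m - f * l) + M / (M - (1 - f) * l) - 2) / l := by
  have h₁ : m / (m - f * l) = 1 + l * (f / (m - f * l)) := by
    field_simp
    ring
  have h₂ : M / (M - (1 - f) * l) = 1 + l * ((1 - f) / (M - (1 - f) * l)) := by
    field_simp
    ring
  rw [h₁, h₂]
  field_simp
  ring

/-- `f*(λ) = max{f_min(λ), 0}` is feasible, minimizes the
tunable-mode delay over the feasible set, and the minimum value has the stated
closed form. -/
theorem tunable_mode_optimal_fraction
    (μ0 K lam : ℝ) (hμ0 : 0 < μ0) (hK : 1 < K)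
    (hlam0 : 0 < lam) (hlam : lam < (K + 1) * μ0)
    (T : ℝ → ℝ)
    (hT : T = fun f => f / (μ0 - f * lam) + (1 - f) / (K * μ0 - (1 - f) * lam))
    (F : Set ℝ)
    (hF : F = Set.Icc 0 1 ∩ Set.Ioo (1 - K * μ0 / lam) (μ0 / lam))
    (fstar : ℝ)
    (hfstar : fstar = max ((lam - μ0 * (K - Real.sqrt K)) / (lam * (1 + Real.sqrt K))) 0) :
    fstar ∈ F ∧
    (∀ f ∈ F, T fstar ≤ T f) ∧
    ((K - Real.sqrt K) * μ0 < lam →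
      T fstar = (2 * lam - (Real.sqrt K - 1) ^ 2 * μ0) / (lam * ((K + 1) * μ0 - lam))) ∧
    (lam ≤ (K - Real.sqrt K) * μ0 → T fstar = 1 / (K * μ0 - lam)) := by
  obtain ⟨s, hs, rfl⟩ : ∃ s : ℝ, 1 < s ∧ K = s ^ 2 :=
    ⟨√K, Real.lt_sqrt_of_sq_lt (by simpa using hK), (Real.sq_sqrt (by linarith)).symm⟩
  have hs0 : 0 < s := by linarith
  rw [Real.sqrt_sq hs0.le] at *
  have hmem : ∀ f, f ∈ F ↔ (0 ≤ f ∧ f ≤ 1) ∧ 0 < s ^ 2 * μ0 - (1 - f) * lam ∧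
      0 < μ0 - f * lam := by
    intro f
    rw [hF, Set.mem_inter_iff, Set.mem_Icc, Set.mem_Ioo, lt_div_iff₀ hlam0, sub_lt_comm,
      lt_div_iff₀ hlam0, sub_pos, sub_pos]
  have hTf : ∀ f ∈ F, T f =
      (μ0 / (μ0 - f * lam) + s ^ 2 * μ0 / (s ^ 2 * μ0 - (1 - f) * lam) - 2) / lam := by
    intro f hf
    obtain ⟨-, hb, ha⟩ := (hmem f).1 hf
    rw [hT]
    exact delay_eq_residual hlam0.ne' ha.ne' hb.ne'
  have hS : 0 < (s ^ 2 + 1) * μ0 - lam := by linarith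
  rcases lt_or_ge ((s ^ 2 - s) * μ0) lam with h | h
  · have hf : fstar = (lam - μ0 * (s ^ 2 - s)) / (lam * (1 + s)) := by
      rw [hfstar, max_eq_left]
      exact div_nonneg (by linarith) (by positivity)
    have hfl : fstar * lam = (lam - μ0 * (s ^ 2 - s)) / (1 + s) := by
      rw [hf]
      field_simp
    have ha : μ0 - fstar * lam = ((s ^ 2 + 1) * μ0 - lam) / (1 + s) := by
      rw [hfl]
      field_simp
      ring
    have hb : s ^ 2 * μ0 - (1 - fstar) * lam = s * ((s ^ 2 + 1) * μ0 - lam) / (1 + s) := by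
      rw [one_sub_mul, hfl]
      field_simp
      ring
    have hfF : fstar ∈ F := by
      rw [hmem, ha, hb]
      refine ⟨⟨?_, ?_⟩, by positivity, by positivity⟩
      · rw [hfstar]
        exact le_max_right _ _
      · rw [hf, div_le_one (by positivity)]
        nlinarith [mul_pos hlam0 hs0, mul_pos (mul_pos hμ0 hs0) (sub_pos.2 hs)]
    have hval : T fstar = (μ0 * ((1 + s) ^ 2 / ((s ^ 2 + 1) * μ0 - lam)) - 2) / lam := by
      rw [hTf _ hfF, ha, hb]
      field_simp
    refine ⟨hfF, fun f hf => ?_, fun _ => ?_, fun h' => absurd h (not_lt.2 h')⟩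
    · obtain ⟨-, hb', ha'⟩ := (hmem f).1 hf
      rw [hval, hTf f hf]
      have key := mul_le_mul_of_nonneg_left (one_add_sq_div_add_le s ha' hb') hμ0.le
      rw [show μ0 - f * lam + (s ^ 2 * μ0 - (1 - f) * lam) = (s ^ 2 + 1) * μ0 - lam by ring] at key
      refine div_le_div_of_nonneg_right (sub_le_sub_right (key.trans_eq ?_) 2) hlam0.le
      ring
    · rw [hval, mul_comm lam, ← div_div]
      congr 1
      rw [eq_div_iff hS.ne', sub_mul, mul_assoc, div_mul_cancel₀ _ hS.ne']
      ring
  · have hf : fstar = 0 := by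
      rw [hfstar, max_eq_right]
      exact div_nonpos_of_nonpos_of_nonneg (by linarith) (by positivity)
    have hb0 : s * μ0 ≤ s ^ 2 * μ0 - lam := by linarith
    have hsμ : 0 < s * μ0 := by positivity
    have hb0' : 0 < s ^ 2 * μ0 - lam := by linarith
    have hval : T fstar = 1 / (s ^ 2 * μ0 - lam) := by
      simp [hT, hf]
    refine ⟨?_, fun f hf' => ?_, fun h' => absurd h (not_le.2 h'), fun _ => hval⟩
    · rw [hmem, hf]
      simp only [le_refl, zero_le_one, true_and, sub_zero, one_mul, zero_mul]
      exact ⟨hb0', hμ0⟩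
    · obtain ⟨⟨h0, -⟩, hb, ha⟩ := (hmem f).1 hf'
      have hd : 0 ≤ f * lam := by positivity
      have hbb : s ^ 2 * μ0 * (μ0 - f * lam) ≤
          (s ^ 2 * μ0 - (1 - f) * lam) * (s ^ 2 * μ0 - lam) := by
        have h₁ : s * μ0 * (s * μ0) ≤ (s ^ 2 * μ0 - (1 - f) * lam) * (s ^ 2 * μ0 - lam) :=
          mul_le_mul (by linarith) hb0 hsμ.le hb.le
        have h₂ : 0 ≤ s ^ 2 * μ0 * (f * lam) := by positivity
        linarith
      have hdiff : T f - T fstar = f * ((s ^ 2 * μ0 - (1 - f) * lam) * (s ^ 2 * μ0 - lam) -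
          s ^ 2 * μ0 * (μ0 - f * lam)) /
          ((μ0 - f * lam) * (s ^ 2 * μ0 - (1 - f) * lam) * (s ^ 2 * μ0 - lam)) := by
        rw [hval]
        simp only [hT]
        rw [div_add_div _ _ ha.ne' hb.ne', div_sub_div _ _ (mul_pos ha hb).ne' hb0'.ne']
        congr 1
        ring
      refine sub_nonneg.1 (hdiff ▸ ?_)
      exact div_nonneg (mul_nonneg h0 (sub_nonneg.2 hbb)) (by positivity)
end

section
/- (Achievability) Let μ_l1, μ_l2, μ_c1, μ_c2 > 0 be real service rates with μ_l2 < μ_l1 and μ_c1 < μ_c2. If 0 < λ < λ_max := min{μ_l1, μ_c2, μ*}, then there exist p, α, β ∈ [0,1] satisfying the four strict stability inequalities: λ·p < α·μ_l1, λ·(1−p) < (1−α)·μ_l2, λ·p < β·μ_c1, and λ·(1−p) < (1−β)·μ_c2. -/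
/-- A server shared between two modes with rates `m` and `n` can be split so as to stabilise
loads `a` and `b` whenever the total utilisation `a / m + b / n` is below one. -/
theorem exists_partition_of_load_lt {a b m n : ℝ} (ha : 0 ≤ a) (hb : 0 ≤ b)
    (hm : 0 < m) (hn : 0 < n) (h : a * n + b * m < m * n) :
    ∃ α ∈ Set.Icc (0 : ℝ) 1, a < α * m ∧ b < (1 - α) * n := by
  have hsum : a / m + b / n < 1 := by
    rw [div_add_div _ _ hm.ne' hn.ne', div_lt_one (mul_pos hm hn)]
    linarith
  obtain ⟨α, hα₁, hα₂⟩ := exists_between (lt_sub_iff_add_lt.mpr hsum)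
  have ham : 0 ≤ a / m := div_nonneg ha hm.le
  have hbn : 0 ≤ b / n := div_nonneg hb hn.le
  exact ⟨α, ⟨by linarith, by linarith⟩, (div_lt_iff₀ hm).mp hα₁,
    (div_lt_iff₀ hn).mp (by linarith)⟩

/-- Achievability: if `0 < λ < min{μ_l1, μ_c2, μ*}`, there exist
`p, α, β ∈ [0,1]` satisfying the four strict stability inequalities. -/
theorem dual_mode_achievability
    (μl1 μl2 μc1 μc2 lam : ℝ)
    (hl1 : 0 < μl1) (hl2 : 0 < μl2) (hc1 : 0 < μc1) (hc2 : 0 < μc2)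
    (hl : μl2 < μl1) (hc : μc1 < μc2)
    (μstar : ℝ)
    (hμstar : μstar = (μc1 * μc2 * (μl1 - μl2) + μl1 * μl2 * (μc2 - μc1)) /
      (μl1 * μc2 - μl2 * μc1))
    (hlam0 : 0 < lam) (hlam : lam < min μl1 (min μc2 μstar)) :
    ∃ p ∈ Set.Icc (0 : ℝ) 1, ∃ α ∈ Set.Icc (0 : ℝ) 1, ∃ β ∈ Set.Icc (0 : ℝ) 1,
      lam * p < α * μl1 ∧ lam * (1 - p) < (1 - α) * μl2 ∧
      lam * p < β * μc1 ∧ lam * (1 - p) < (1 - β) * μc2 := by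
  obtain ⟨h₁, h₂, h₃⟩ : lam < μl1 ∧ lam < μc2 ∧ lam < μstar := by
    simpa only [lt_min_iff] using hlam
  have hdet : 0 < μl1 * μc2 - μl2 * μc1 :=
    sub_pos.mpr (mul_lt_mul'' hl hc hl2.le hc1.le)
  rw [hμstar, lt_div_iff₀ hdet] at h₃
  have hdl : 0 < lam * (μl1 - μl2) := mul_pos hlam0 (sub_pos.mpr hl)
  have hdc : 0 < lam * (μc2 - μc1) := mul_pos hlam0 (sub_pos.mpr hc)
  have hlocal : μl1 * (lam - μl2) / (lam * (μl1 - μl2)) < 1 := by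
    rw [div_lt_one hdl]
    linarith [mul_lt_mul_of_pos_right h₁ hl2]
  have hcloud : 0 < μc1 * (μc2 - lam) / (lam * (μc2 - μc1)) :=
    div_pos (mul_pos hc1 (sub_pos.mpr h₂)) hdc
  have hcross : μl1 * (lam - μl2) / (lam * (μl1 - μl2)) <
      μc1 * (μc2 - lam) / (lam * (μc2 - μc1)) := by
    rw [div_lt_div_iff₀ hdl hdc]
    linarith [mul_lt_mul_of_pos_left h₃ hlam0]
  obtain ⟨p, hp₁, hp₂⟩ := exists_between
    (max_lt (lt_min one_pos hcloud) (lt_min hlocal hcross))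
  obtain ⟨hp0, hpl⟩ := max_lt_iff.mp hp₁
  obtain ⟨hp1, hpc⟩ := lt_min_iff.mp hp₂
  rw [div_lt_iff₀ hdl] at hpl
  rw [lt_div_iff₀ hdc] at hpc
  have ha : 0 ≤ lam * p := mul_nonneg hlam0.le hp0.le
  have hb : 0 ≤ lam * (1 - p) := mul_nonneg hlam0.le (sub_nonneg.mpr hp1.le)
  obtain ⟨α, hα, hα₁, hα₂⟩ := exists_partition_of_load_lt ha hb hl1 hl2 (by linarith)
  obtain ⟨β, hβ, hβ₁, hβ₂⟩ := exists_partition_of_load_lt ha hb hc1 hc2 (by linarith)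
  exact ⟨p, ⟨hp0.le, hp1.le⟩, α, hα, β, hβ, hα₁, hα₂, hβ₁, hβ₂⟩
end

section
/- (Converse) Let μ_l1, μ_l2, μ_c1, μ_c2 > 0 be real service rates with μ_l2 < μ_l1 and μ_c1 < μ_c2. If λ ≥ λ_max := min{μ_l1, μ_c2, μ*}, then there exist no p, α, β ∈ [0,1] satisfying all four strict stability inequalities: λ·p < α·μ_l1, λ·(1−p) < (1−α)·μ_l2, λ·p < β·μ_c1, and λ·(1−p) < (1−β)·μ_c2. -/
/-- Converse: if `λ ≥ min{μ_l1, μ_c2, μ*}`, no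
`p, α, β ∈ [0,1]` satisfy all four strict stability inequalities. -/
theorem dual_mode_converse
    (μl1 μl2 μc1 μc2 lam : ℝ)
    (hl1 : 0 < μl1) (hl2 : 0 < μl2) (hc1 : 0 < μc1) (hc2 : 0 < μc2)
    (hl : μl2 < μl1) (hc : μc1 < μc2)
    (μstar : ℝ)
    (hμstar : μstar = (μc1 * μc2 * (μl1 - μl2) + μl1 * μl2 * (μc2 - μc1)) /
      (μl1 * μc2 - μl2 * μc1))
    (hlam : min μl1 (min μc2 μstar) ≤ lam) :
    ¬ ∃ p ∈ Set.Icc (0 : ℝ) 1, ∃ α ∈ Set.Icc (0 : ℝ) 1, ∃ β ∈ Set.Icc (0 : ℝ) 1,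
      lam * p < α * μl1 ∧ lam * (1 - p) < (1 - α) * μl2 ∧
      lam * p < β * μc1 ∧ lam * (1 - p) < (1 - β) * μc2 := by
  rintro ⟨p, ⟨hp0, hp1⟩, α, -, β, -, h1, h2, h3, h4⟩
  have hD : 0 < μl1 * μc2 - μl2 * μc1 := by
    have := mul_lt_mul hl hc.le hc1 hl1.le
    linarith
  have hstar : 0 < μstar := by
    rw [hμstar]
    have := sub_pos.2 hl
    have := sub_pos.2 hc
    positivity
  have hlam0 : 0 < lam := (lt_min hl1 (lt_min hc2 hstar)).trans_le hlam
  have hx : 0 ≤ lam * p := by positivity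
  have hy : 0 ≤ lam * (1 - p) := mul_nonneg hlam0.le (sub_nonneg.2 hp1)
  have hlocal : lam * p * μl2 + lam * (1 - p) * μl1 < μl1 * μl2 := by
    have e1 := mul_lt_mul_of_pos_right h1 hl2
    have e2 := mul_lt_mul_of_pos_right h2 hl1
    linarith
  have hcloud : lam * p * μc2 + lam * (1 - p) * μc1 < μc1 * μc2 := by
    have e1 := mul_lt_mul_of_pos_right h3 hc2
    have e2 := mul_lt_mul_of_pos_right h4 hc1
    linarith
  have hlt_l1 : lam < μl1 := by
    refine lt_of_mul_lt_mul_right ?_ hl2.le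
    have := mul_le_mul_of_nonneg_left hl.le hy
    linarith
  have hlt_c2 : lam < μc2 := by
    refine lt_of_mul_lt_mul_right ?_ hc1.le
    have := mul_le_mul_of_nonneg_left hc.le hx
    linarith
  have hlt_star : lam < μstar := by
    rw [hμstar, lt_div_iff₀ hD]
    have e1 := mul_lt_mul_of_pos_right hlocal (sub_pos.2 hc)
    have e2 := mul_lt_mul_of_pos_right hcloud (sub_pos.2 hl)
    linarith
  exact hlam.not_gt (lt_min hlt_l1 (lt_min hlt_c2 hlt_star))
end

section
/- (Stability region) Let μ_l1, μ_l2, μ_c1, μ_c2 > 0 be real service rates with μ_l2 < μ_l1 and μ_c1 < μ_c2, and let λ > 0. Then there exist p, α, β ∈ [0,1] satisfying λ·p < α·μ_l1, λ·(1−p) < (1−α)·μ_l2, λ·p < β·μ_c1, and λ·(1−p) < (1−β)·μ_c2 if and only if λ < λ_max := min{μ_l1, μ_c2, μ*}. -/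
/-- Two arrival rates `a`, `b` can be served strictly by time-sharing rates `m`, `n` as soon as
the total load is below one. -/
lemma exists_time_share {a b m n : ℝ} (ha : 0 ≤ a) (hb : 0 ≤ b) (hm : 0 < m) (hn : 0 < n)
    (h : a * n + b * m < m * n) :
    ∃ t ∈ Set.Icc (0 : ℝ) 1, a < t * m ∧ b < (1 - t) * n := by
  have hlt : a / m < 1 - b / n := by
    rw [lt_sub_iff_add_lt, div_add_div _ _ hm.ne' hn.ne', div_lt_one (mul_pos hm hn)]
    linarith
  obtain ⟨t, h1, h2⟩ := exists_between hlt
  have h3 : b / n < 1 - t := by linarith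
  have ham : 0 ≤ a / m := by positivity
  have hbn : 0 ≤ b / n := by positivity
  exact ⟨t, ⟨by linarith, by linarith⟩, (div_lt_iff₀ hm).1 h1, (div_lt_iff₀ hn).1 h3⟩

/-- Rates served strictly by time-sharing have total load below one. -/
lemma load_lt_of_time_share {a b m n t : ℝ} (hm : 0 < m) (hn : 0 < n)
    (h1 : a < t * m) (h2 : b < (1 - t) * n) : a * n + b * m < m * n := by
  have := mul_lt_mul_of_pos_right h1 hn
  have := mul_lt_mul_of_pos_right h2 hm
  linarith


/-- Stability region: stabilizing `p, α, β ∈ [0,1]` exist iff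
`λ < min{μ_l1, μ_c2, μ*}`. -/
theorem dual_mode_stability_region
    (μl1 μl2 μc1 μc2 lam : ℝ)
    (hl1 : 0 < μl1) (hl2 : 0 < μl2) (hc1 : 0 < μc1) (hc2 : 0 < μc2)
    (hl : μl2 < μl1) (hc : μc1 < μc2)
    (μstar : ℝ)
    (hμstar : μstar = (μc1 * μc2 * (μl1 - μl2) + μl1 * μl2 * (μc2 - μc1)) /
      (μl1 * μc2 - μl2 * μc1))
    (hlam0 : 0 < lam) :
    (∃ p ∈ Set.Icc (0 : ℝ) 1, ∃ α ∈ Set.Icc (0 : ℝ) 1, ∃ β ∈ Set.Icc (0 : ℝ) 1,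
      lam * p < α * μl1 ∧ lam * (1 - p) < (1 - α) * μl2 ∧
      lam * p < β * μc1 ∧ lam * (1 - p) < (1 - β) * μc2) ↔
    lam < min μl1 (min μc2 μstar) := by
  have hD : 0 < μl1 * μc2 - μl2 * μc1 := sub_pos.2 (mul_lt_mul'' hl hc hl2.le hc1.le)
  have hl' : 0 < μl1 - μl2 := sub_pos.2 hl
  have hc' : 0 < μc2 - μc1 := sub_pos.2 hc
  rw [lt_min_iff, lt_min_iff, hμstar, lt_div_iff₀ hD]
  constructor
  · rintro ⟨p, ⟨hp0, hp1⟩, α, -, β, -, h1, h2, h3, h4⟩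
    have hL := load_lt_of_time_share hl1 hl2 h1 h2
    have hC := load_lt_of_time_share hc1 hc2 h3 h4
    have ha : 0 ≤ lam * p := mul_nonneg hlam0.le hp0
    have hb : 0 ≤ lam * (1 - p) := mul_nonneg hlam0.le (sub_nonneg.2 hp1)
    refine ⟨?_, ?_, ?_⟩
    · refine lt_of_mul_lt_mul_right (a := μl2) ?_ hl2.le
      linarith [mul_nonneg hb hl'.le]
    · refine lt_of_mul_lt_mul_right (a := μc1) ?_ hc1.le
      linarith [mul_nonneg ha hc'.le]
    · linarith [mul_lt_mul_of_pos_right hL hc', mul_lt_mul_of_pos_right hC hl']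
  · rintro ⟨h1, h2, h3⟩
    have hA : μl1 * (lam - μl2) / (μl1 - μl2) < lam := by
      rw [div_lt_iff₀ hl']
      linarith [mul_lt_mul_of_pos_right h1 hl2]
    have hB : 0 < μc1 * (μc2 - lam) / (μc2 - μc1) :=
      div_pos (mul_pos hc1 (sub_pos.2 h2)) hc'
    have hAB : μl1 * (lam - μl2) / (μl1 - μl2) < μc1 * (μc2 - lam) / (μc2 - μc1) := by
      rw [div_lt_div_iff₀ hl' hc']
      linarith
    obtain ⟨a, ha1, ha2⟩ := exists_between (max_lt (lt_min hlam0 hB) (lt_min hA hAB))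
    obtain ⟨ha0, haA⟩ := max_lt_iff.1 ha1
    obtain ⟨hal, haB⟩ := lt_min_iff.1 ha2
    rw [div_lt_iff₀ hl'] at haA
    rw [lt_div_iff₀ hc'] at haB
    have hb0 : 0 ≤ lam - a := sub_nonneg.2 hal.le
    obtain ⟨α, hα, hα1, hα2⟩ := exists_time_share ha0.le hb0 hl1 hl2 (by linarith)
    obtain ⟨β, hβ, hβ1, hβ2⟩ := exists_time_share ha0.le hb0 hc1 hc2 (by linarith)
    have hp : lam * (a / lam) = a := mul_div_cancel₀ a hlam0.ne'
    have hq : lam * (1 - a / lam) = lam - a := by rw [mul_sub, hp, mul_one]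
    refine ⟨a / lam, ⟨by positivity, (div_le_one hlam0).2 hal.le⟩, α, hα, β, hβ, ?_⟩
    rw [hp, hq]
    exact ⟨hα1, hα2, hβ1, hβ2⟩
end

section
/- Let μ_l1, μ_l2, μ_c1, μ_c2 > 0 be real service rates with μ_l2 < μ_l1 and μ_c1 < μ_c2, and let λ be a real number with 0 < λ < min{μ_l1, μ_c2}. Define p_min := 1 − (1/λ − 1/μ_l1)/(1/μ_l2 − 1/μ_l1) and p_max := (1/λ − 1/μ_c2)/(1/μ_c1 − 1/μ_c2). Then p_min < p_max if and only if λ < μ*; moreover p_min < 1 and p_max > 0. -/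
/-- The fraction of the way from `1 / b` to `1 / a` at which `1 / x` lies. -/
theorem one_div_sub_div_one_div_sub {a b x : ℝ} (ha : a ≠ 0) (hb : b ≠ 0) (hx : x ≠ 0) :
    (1 / x - 1 / b) / (1 / a - 1 / b) = a * (b - x) / (x * (b - a)) := by
  rw [div_sub_div _ _ hx hb, div_sub_div _ _ ha hb, one_mul, mul_one, mul_one,
    div_div_div_eq, show (b - x) * (a * b) = a * (b - x) * b by ring,
    show x * b * (b - a) = x * (b - a) * b by ring, mul_div_mul_right _ _ hb]

/-- with `0 < λ < min{μ_l1, μ_c2}`, one has `p_min < p_max` iff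
`λ < μ*`; moreover `p_min < 1` and `p_max > 0`. -/
theorem dual_mode_pmin_pmax
    (μl1 μl2 μc1 μc2 lam : ℝ)
    (hl1 : 0 < μl1) (hl2 : 0 < μl2) (hc1 : 0 < μc1) (hc2 : 0 < μc2)
    (hl : μl2 < μl1) (hc : μc1 < μc2)
    (μstar : ℝ)
    (hμstar : μstar = (μc1 * μc2 * (μl1 - μl2) + μl1 * μl2 * (μc2 - μc1)) /
      (μl1 * μc2 - μl2 * μc1))
    (hlam0 : 0 < lam) (hlam : lam < min μl1 μc2)
    (pmin pmax : ℝ)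
    (hpmin : pmin = 1 - (1 / lam - 1 / μl1) / (1 / μl2 - 1 / μl1))
    (hpmax : pmax = (1 / lam - 1 / μc2) / (1 / μc1 - 1 / μc2)) :
    (pmin < pmax ↔ lam < μstar) ∧ pmin < 1 ∧ 0 < pmax := by
  obtain ⟨hlaml, hlamc⟩ := lt_min_iff.mp hlam
  have hl' : 0 < μl1 - μl2 := sub_pos.mpr hl
  have hc' : 0 < μc2 - μc1 := sub_pos.mpr hc
  have hD : 0 < μl1 * μc2 - μl2 * μc1 :=
    sub_pos.mpr (mul_lt_mul hl hc.le hc1 hl1.le)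
  rw [one_div_sub_div_one_div_sub hl2.ne' hl1.ne' hlam0.ne'] at hpmin
  rw [one_div_sub_div_one_div_sub hc1.ne' hc2.ne' hlam0.ne'] at hpmax
  have hdiff : pmax - pmin =
      (μc1 * μc2 * (μl1 - μl2) + μl1 * μl2 * (μc2 - μc1) - lam * (μl1 * μc2 - μl2 * μc1)) /
        (lam * (μl1 - μl2) * (μc2 - μc1)) := by
    rw [hpmin, hpmax]
    field_simp
    ring
  refine ⟨?_, ?_, ?_⟩
  · rw [← sub_pos, hdiff, div_pos_iff_of_pos_right (by positivity), sub_pos, hμstar,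
      lt_div_iff₀ hD]
  · rw [hpmin]
    exact sub_lt_self _ (div_pos (mul_pos hl2 (sub_pos.mpr hlaml)) (mul_pos hlam0 hl'))
  · rw [hpmax]
    exact div_pos (mul_pos hc1 (sub_pos.mpr hlamc)) (mul_pos hlam0 hc')
end

section
/- (Optimal resource allocation) Let μ_l1, μ_l2, μ_c1, μ_c2 > 0 be real service rates with μ_l2 < μ_l1 and μ_c1 < μ_c2, let λ > 0, and let p ∈ [0,1] satisfy λ·p/μ_l1 + λ·(1−p)/μ_l2 < 1 and λ·p/μ_c1 + λ·(1−p)/μ_c2 < 1. Define α*(p;λ) := ((λ·p/μ_l1)·√((1−p)/μ_l2) + (1 − λ·(1−p)/μ_l2)·√(p/μ_l1)) / (√(p/μ_l1) + √((1−p)/μ_l2)) and β*(p;λ) := ((λ·p/μ_c1)·√((1−p)/μ_c2) + (1 − λ·(1−p)/μ_c2)·√(p/μ_c1)) / (√(p/μ_c1) + √((1−p)/μ_c2)). Then α*(p;λ), β*(p;λ) ∈ [0,1]; for every (α, β) ∈ [0,1]×[0,1] with all four denominators α·μ_l1 − λ·p, (1−α)·μ_l2 − λ·(1−p), β·μ_c1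 − λ·p, (1−β)·μ_c2 − λ·(1−p) strictly positive, one has T_DM(p, α, β; λ) ≥ (√(p/μ_l1) + √((1−p)/μ_l2))² / (1 − λ·p/μ_l1 − λ·(1−p)/μ_l2) + (√(p/μ_c1) + √((1−p)/μ_c2))² / (1 − λ·p/μ_c1 − λ·(1−p)/μ_c2); and equality holds at (α, β) = (α*(p;λ), β*(p;λ)). -/
/-- Cauchy-Schwarz in Engel form, for two terms. -/
lemma add_sq_div_add_le {a b x y : ℝ} (hx : 0 < x) (hy : 0 < y) :
    (a + b) ^ 2 / (x + y) ≤ a ^ 2 / x + b ^ 2 / y := by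
  rw [div_add_div _ _ hx.ne' hy.ne', div_le_div_iff₀ (by positivity) (by positivity)]
  have key : 0 ≤ (a * y - b * x) ^ 2 := sq_nonneg _
  nlinarith [key]

/-- The equality case of `add_sq_div_add_le`: weights proportional to `a` and `b`. -/
lemma sq_div_proportional_add (a b d : ℝ) :
    a ^ 2 / (a * d / (a + b)) + b ^ 2 / (b * d / (a + b)) = (a + b) ^ 2 / d := by
  have h : ∀ c : ℝ, c ^ 2 / (c * d / (a + b)) = c * ((a + b) / d) := by
    intro c
    rcases eq_or_ne c 0 with rfl | hc
    · simp
    · rw [div_div_eq_mul_div, sq, mul_assoc, mul_div_mul_left _ _ hc, mul_div_assoc]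
  rw [h, h]
  ring

/-- Dividing numerator and denominator of a delay term by the service rate. -/
lemma delay_term_eq {q μ lam γ : ℝ} (hμ : 0 < μ) (hq : 0 ≤ q) :
    q / (γ * μ - lam * q) = √(q / μ) ^ 2 / (γ - lam * √(q / μ) ^ 2) := by
  rw [Real.sq_sqrt (by positivity), ← mul_div_mul_right (q / μ) _ hμ.ne']
  congr 1 <;> field_simp

/-- Optimal partition of one server between the two modes. -/
lemma single_server_allocation {μ₁ μ₂ lam p : ℝ} (h₁ : 0 < μ₁) (h₂ : 0 < μ₂) (hlam : 0 < lam)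
    (hp : p ∈ Set.Icc (0 : ℝ) 1) (hstab : lam * p / μ₁ + lam * (1 - p) / μ₂ < 1)
    {γ : ℝ} (hγ : γ = ((lam * p / μ₁) * √((1 - p) / μ₂) +
        (1 - lam * (1 - p) / μ₂) * √(p / μ₁)) / (√(p / μ₁) + √((1 - p) / μ₂))) :
    γ ∈ Set.Icc (0 : ℝ) 1 ∧
    (∀ α : ℝ, 0 < α * μ₁ - lam * p → 0 < (1 - α) * μ₂ - lam * (1 - p) →
      (√(p / μ₁) + √((1 - p) / μ₂)) ^ 2 / (1 - lam * p / μ₁ - lam * (1 - p) / μ₂) ≤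
        p / (α * μ₁ - lam * p) + (1 - p) / ((1 - α) * μ₂ - lam * (1 - p))) ∧
    p / (γ * μ₁ - lam * p) + (1 - p) / ((1 - γ) * μ₂ - lam * (1 - p)) =
      (√(p / μ₁) + √((1 - p) / μ₂)) ^ 2 / (1 - lam * p / μ₁ - lam * (1 - p) / μ₂) := by
  obtain ⟨hp0, hp1⟩ := hp
  have hq0 : 0 ≤ 1 - p := sub_nonneg.2 hp1
  have ha2 : lam * p / μ₁ = lam * √(p / μ₁) ^ 2 := by
    rw [Real.sq_sqrt (by positivity), mul_div_assoc]
  have hb2 : lam * (1 - p) / μ₂ = lam * √((1 - p) / μ₂) ^ 2 := by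
    rw [Real.sq_sqrt (by positivity), mul_div_assoc]
  have hab : 0 < √(p / μ₁) + √((1 - p) / μ₂) := by
    rcases hp0.eq_or_lt with rfl | hp0
    · exact add_pos_of_nonneg_of_pos (Real.sqrt_nonneg _) (Real.sqrt_pos.2 (by positivity))
    · exact add_pos_of_pos_of_nonneg (Real.sqrt_pos.2 (by positivity)) (Real.sqrt_nonneg _)
  have hx : ∀ α : ℝ, 0 < α * μ₁ - lam * p → 0 < α - lam * √(p / μ₁) ^ 2 := by
    intro α h
    rw [← ha2, sub_pos, div_lt_iff₀ h₁]
    linarith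
  have hy : ∀ α : ℝ, 0 < (1 - α) * μ₂ - lam * (1 - p) →
      0 < 1 - α - lam * √((1 - p) / μ₂) ^ 2 := by
    intro α h
    rw [← hb2, sub_pos, div_lt_iff₀ h₂]
    linarith
  simp only [delay_term_eq h₁ hp0, delay_term_eq h₂ hq0]
  rw [ha2, hb2] at hstab hγ ⊢
  have ha : 0 ≤ √(p / μ₁) := Real.sqrt_nonneg _
  have hb : 0 ≤ √((1 - p) / μ₂) := Real.sqrt_nonneg _
  generalize √(p / μ₁) = a at *
  generalize √((1 - p) / μ₂) = b at *
  have hd : 0 < 1 - lam * a ^ 2 - lam * b ^ 2 := by linarith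
  have hγa : γ - lam * a ^ 2 = a * (1 - lam * a ^ 2 - lam * b ^ 2) / (a + b) := by
    rw [hγ]
    field_simp
    ring
  have hγb : 1 - γ - lam * b ^ 2 = b * (1 - lam * a ^ 2 - lam * b ^ 2) / (a + b) := by
    rw [hγ]
    field_simp
    ring
  refine ⟨⟨?_, ?_⟩, fun α hα hα' => ?_, ?_⟩
  · have : 0 ≤ γ - lam * a ^ 2 := by rw [hγa]; positivity
    linarith [show 0 ≤ lam * a ^ 2 by positivity]
  · have : 0 ≤ 1 - γ - lam * b ^ 2 := by rw [hγb]; positivity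
    linarith [show 0 ≤ lam * b ^ 2 by positivity]
  · convert add_sq_div_add_le (a := a) (b := b) (hx α hα) (hy α hα') using 2
    ring
  · rw [hγa, hγb, sq_div_proportional_add]

/-- Optimal resource allocation: the partition parameters
`α*, β*` are feasible and achieve the stated minimum of the dual-mode delay. -/
theorem optimal_resource_allocation
    (μl1 μl2 μc1 μc2 lam p : ℝ)
    (hl1 : 0 < μl1) (hl2 : 0 < μl2) (hc1 : 0 < μc1) (hc2 : 0 < μc2)
    (hl : μl2 < μl1) (hc : μc1 < μc2)
    (hlam : 0 < lam) (hp : p ∈ Set.Icc (0 : ℝ) 1)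
    (hstabl : lam * p / μl1 + lam * (1 - p) / μl2 < 1)
    (hstabc : lam * p / μc1 + lam * (1 - p) / μc2 < 1)
    (T : ℝ → ℝ → ℝ)
    (hT : T = fun α β =>
      p / (α * μl1 - lam * p) + (1 - p) / ((1 - α) * μl2 - lam * (1 - p)) +
      p / (β * μc1 - lam * p) + (1 - p) / ((1 - β) * μc2 - lam * (1 - p)))
    (αstar βstar Tstar : ℝ)
    (hαstar : αstar =
      ((lam * p / μl1) * Real.sqrt ((1 - p) / μl2) +
        (1 - lam * (1 - p) / μl2) * Real.sqrt (p / μl1)) /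
      (Real.sqrt (p / μl1) + Real.sqrt ((1 - p) / μl2)))
    (hβstar : βstar =
      ((lam * p / μc1) * Real.sqrt ((1 - p) / μc2) +
        (1 - lam * (1 - p) / μc2) * Real.sqrt (p / μc1)) /
      (Real.sqrt (p / μc1) + Real.sqrt ((1 - p) / μc2)))
    (hTstar : Tstar =
      (Real.sqrt (p / μl1) + Real.sqrt ((1 - p) / μl2)) ^ 2 /
        (1 - lam * p / μl1 - lam * (1 - p) / μl2) +
      (Real.sqrt (p / μc1) + Real.sqrt ((1 - p) / μc2)) ^ 2 /
        (1 - lam * p / μc1 - lam * (1 - p) / μc2)) :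
    αstar ∈ Set.Icc (0 : ℝ) 1 ∧ βstar ∈ Set.Icc (0 : ℝ) 1 ∧
    (∀ α ∈ Set.Icc (0 : ℝ) 1, ∀ β ∈ Set.Icc (0 : ℝ) 1,
      0 < α * μl1 - lam * p → 0 < (1 - α) * μl2 - lam * (1 - p) →
      0 < β * μc1 - lam * p → 0 < (1 - β) * μc2 - lam * (1 - p) →
      Tstar ≤ T α β) ∧
    T αstar βstar = Tstar := by
  obtain ⟨hα, hαle, hαeq⟩ := single_server_allocation hl1 hl2 hlam hp hstabl hαstar
  obtain ⟨hβ, hβle, hβeq⟩ := single_server_allocation hc1 hc2 hlam hp hstabc hβstar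
  subst hT hTstar
  refine ⟨hα, hβ, fun α _ β _ h₁ h₂ h₃ h₄ => ?_, ?_⟩
  · linarith [hαle α h₁ h₂, hβle β h₃ h₄]
  · linarith
end

section
/- (Delay decomposition) Let μ0 > 0, K > 1, and 0 ≤ f1 < f2 ≤ 1 be real canonical parameters, let λ > 0, and let p ∈ P_λ. Then T*_DM(p;λ) = T_TM(f(p);λ) + T_OH(p;λ), where T_OH(p;λ) := 2·√(p·(1−p))·( √(f1·f2)/(μ0 − λ·f(p)) + √((1−f1)·(1−f2))/(K·μ0 − λ·(1−f(p))) ); moreover T_OH(p;λ) ≥ 0. -/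
/-- Expansion of the square of `√(p a) + √((1 - p) b)`. -/
theorem sq_sqrt_mul_add_sqrt_mul {p a b : ℝ} (hp0 : 0 ≤ p) (hp1 : p ≤ 1)
    (ha : 0 ≤ a) (hb : 0 ≤ b) :
    (Real.sqrt (p * a) + Real.sqrt ((1 - p) * b)) ^ 2 =
      p * a + (1 - p) * b + 2 * Real.sqrt (p * (1 - p)) * Real.sqrt (a * b) := by
  have hq : 0 ≤ 1 - p := sub_nonneg.2 hp1
  have hcross : Real.sqrt (p * a) * Real.sqrt ((1 - p) * b) =
      Real.sqrt (p * (1 - p)) * Real.sqrt (a * b) := by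
    rw [← Real.sqrt_mul (mul_nonneg hp0 ha), ← Real.sqrt_mul (mul_nonneg hp0 hq),
      mul_mul_mul_comm]
  rw [add_sq, Real.sq_sqrt (mul_nonneg hp0 ha), Real.sq_sqrt (mul_nonneg hq hb),
    mul_assoc 2, hcross]
  ring

/-- Delay decomposition: `T*_DM(p;λ) = T_TM(f(p);λ) + T_OH(p;λ)`
with a nonnegative overhead term. -/
theorem delay_decomposition
    (μ0 K f1 f2 lam p : ℝ)
    (hμ0 : 0 < μ0) (hK : 1 < K)
    (hf1 : 0 ≤ f1) (h12 : f1 < f2) (hf2 : f2 ≤ 1)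
    (hlam : 0 < lam)
    (fp : ℝ) (hfp : fp = p * f1 + (1 - p) * f2)
    (hp : p ∈ Set.Icc (0 : ℝ) 1)
    (hs1 : lam * fp < μ0) (hs2 : lam * (1 - fp) < K * μ0)
    (TDM TTM TOH : ℝ)
    (hTDM : TDM =
      (Real.sqrt (p * f1) + Real.sqrt ((1 - p) * f2)) ^ 2 / (μ0 - lam * fp) +
      (Real.sqrt (p * (1 - f1)) + Real.sqrt ((1 - p) * (1 - f2))) ^ 2 /
        (K * μ0 - lam * (1 - fp)))
    (hTTM : TTM = fp / (μ0 - fp * lam) + (1 - fp) / (K * μ0 - (1 - fp) * lam))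
    (hTOH : TOH = 2 * Real.sqrt (p * (1 - p)) *
      (Real.sqrt (f1 * f2) / (μ0 - lam * fp) +
       Real.sqrt ((1 - f1) * (1 - f2)) / (K * μ0 - lam * (1 - fp)))) :
    TDM = TTM + TOH ∧ 0 ≤ TOH := by
  obtain ⟨hp0, hp1⟩ := hp
  have hd1 : 0 < μ0 - lam * fp := sub_pos.2 hs1
  have hd2 : 0 < K * μ0 - lam * (1 - fp) := sub_pos.2 hs2
  constructor
  · have hremote : 1 - fp = p * (1 - f1) + (1 - p) * (1 - f2) := by rw [hfp]; ring
    rw [hTDM, hTTM, hTOH, sq_sqrt_mul_add_sqrt_mul hp0 hp1 hf1 (hf1.trans h12.le),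
      sq_sqrt_mul_add_sqrt_mul hp0 hp1 (by linarith) (sub_nonneg.2 hf2), ← hfp, ← hremote,
      mul_comm fp lam, mul_comm (1 - fp) lam]
    ring
  · rw [hTOH]
    positivity
end

section
/- (Lower bound) Let μ0 > 0, K > 1, and 0 ≤ f1 < f2 ≤ 1 be real canonical parameters, and let λ satisfy 0 < λ < (K+1)·μ0. Then for every p ∈ P_λ, the optimal dual-mode delay is bounded below by the optimal tunable-mode delay: T*_DM(p;λ) ≥ T_TM(f*(λ);λ), where f*(λ) := max{(λ − μ0·(K − √K))/(λ·(1+√K)), 0}. -/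
/-- The square of a sum of square roots dominates the sum of the radicands. -/
theorem add_le_sq_sqrt_add_sqrt {a b : ℝ} (ha : 0 ≤ a) (hb : 0 ≤ b) :
    a + b ≤ (Real.sqrt a + Real.sqrt b) ^ 2 := by
  nlinarith [Real.sq_sqrt ha, Real.sq_sqrt hb,
    mul_nonneg (Real.sqrt_nonneg a) (Real.sqrt_nonneg b)]

/-- The tunable-mode delay is affine in the sum of service rate over residual capacity. -/
theorem tunable_delay_eq {m M lam g : ℝ} (hlam : 0 < lam)
    (hx : 0 < m - g * lam) (hy : 0 < M - (1 - g) * lam) :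
    g / (m - g * lam) + (1 - g) / (M - (1 - g) * lam) =
      (m / (m - g * lam) + M / (M - (1 - g) * lam) - 2) / lam := by
  have h1 : m / (m - g * lam) = 1 + lam * (g / (m - g * lam)) := by
    rw [← mul_div_assoc, div_eq_iff hx.ne', add_mul, div_mul_cancel₀ _ hx.ne']
    ring
  have h2 : M / (M - (1 - g) * lam) = 1 + lam * ((1 - g) / (M - (1 - g) * lam)) := by
    rw [← mul_div_assoc, div_eq_iff hy.ne', add_mul, div_mul_cancel₀ _ hy.ne']
    ring
  rw [h1, h2]
  field_simp
  ring

/-- Splitting a total residual capacity in the ratio `1 : s` minimizes `1 / x + s ^ 2 / y`. -/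
theorem one_div_add_sq_div_le {s x y u v : ℝ} (hs : 0 < s)
    (hx : 0 < x) (hy : 0 < y) (hu : 0 < u) (hv : v = s * u) (h : x + y = u + v) :
    1 / u + s ^ 2 / v ≤ 1 / x + s ^ 2 / y := by
  subst hv
  obtain rfl : u = (x + y) / (1 + s) := by
    field_simp
    linarith
  rw [← sub_nonneg]
  have : 1 / x + s ^ 2 / y - (1 / ((x + y) / (1 + s)) + s ^ 2 / (s * ((x + y) / (1 + s)))) =
      (y - s * x) ^ 2 / (x * y * (x + y)) := by
    field_simp
    ring
  rw [this]
  positivity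

/-- With total residual capacity fixed, `1 / x + s ^ 2 / y` decreases in `x` while `s * x ≤ y`. -/
theorem one_div_add_sq_div_le_of_le {s x y u v : ℝ} (hs : 0 < s)
    (hx : 0 < x) (hxu : x ≤ u) (hv : s * u ≤ v) (h : x + y = u + v) :
    1 / u + s ^ 2 / v ≤ 1 / x + s ^ 2 / y := by
  have hu : 0 < u := hx.trans_le hxu
  have hv0 : 0 < v := (mul_pos hs hu).trans_le hv
  have hy : 0 < y := by linarith
  have hsx : s * x ≤ y := by nlinarith
  have hprod : (s * x) * (s * u) ≤ y * v :=
    mul_le_mul hsx hv (by positivity) hy.le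
  rw [← sub_nonneg]
  have : 1 / x + s ^ 2 / y - (1 / u + s ^ 2 / v) =
      (u - x) * (y * v - (s * x) * (s * u)) / (x * u * y * v) := by
    obtain rfl : y = u + v - x := by linarith
    field_simp
    ring
  rw [this]
  exact div_nonneg (mul_nonneg (by linarith) (by linarith)) (by positivity)

/-- The tunable-mode delay is minimized at the truncated stationary point. -/
theorem tunable_delay_min {m s lam g : ℝ} (hm : 0 < m) (hs : 1 < s)
    (hlam0 : 0 < lam) (hg : 0 ≤ g)
    (hx : 0 < m - g * lam) (hy : 0 < s ^ 2 * m - (1 - g) * lam) {c : ℝ}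
    (hc : c = max ((lam - m * (s ^ 2 - s)) / (lam * (1 + s))) 0) :
    c / (m - c * lam) + (1 - c) / (s ^ 2 * m - (1 - c) * lam) ≤
      g / (m - g * lam) + (1 - g) / (s ^ 2 * m - (1 - g) * lam) := by
  have hs0 : 0 < s := by linarith
  have key (u v : ℝ) : m / u + s ^ 2 * m / v = m * (1 / u + s ^ 2 / v) := by ring
  have hsum : (m - g * lam) + (s ^ 2 * m - (1 - g) * lam) =
      (m - c * lam) + (s ^ 2 * m - (1 - c) * lam) := by ring
  suffices H : 0 < m - c * lam ∧ 0 < s ^ 2 * m - (1 - c) * lam ∧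
      1 / (m - c * lam) + s ^ 2 / (s ^ 2 * m - (1 - c) * lam) ≤
        1 / (m - g * lam) + s ^ 2 / (s ^ 2 * m - (1 - g) * lam) by
    obtain ⟨hu, hv, H⟩ := H
    rw [tunable_delay_eq hlam0 hu hv, tunable_delay_eq hlam0 hx hy, key, key]
    gcongr
  rcases le_total (lam - m * (s ^ 2 - s)) 0 with h | h
  · rw [max_eq_right (div_nonpos_of_nonpos_of_nonneg h (by positivity))] at hc
    subst hc
    have hsv : s * m ≤ s ^ 2 * m - lam := by linarith
    have hsm : 0 < s * m := by positivity
    refine ⟨by linarith, by linarith, one_div_add_sq_div_le_of_le hs0 hx ?_ ?_ hsum⟩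
    · nlinarith
    · linarith
  · rw [max_eq_left (div_nonneg h (by positivity))] at hc
    have hcl : c * lam = (lam - m * (s ^ 2 - s)) / (1 + s) := by
      rw [hc]
      field_simp
    have hu : m - c * lam = ((s ^ 2 + 1) * m - lam) / (1 + s) := by
      rw [hcl]
      field_simp
      ring
    have hv : s ^ 2 * m - (1 - c) * lam = s * (m - c * lam) := by
      rw [one_sub_mul, hcl]
      field_simp
      ring
    have hu0 : 0 < m - c * lam := by
      rw [hu]
      exact div_pos (by linarith) (by linarith)
    exact ⟨hu0, hv ▸ mul_pos hs0 hu0, one_div_add_sq_div_le hs0 hx hy hu0 hv hsum⟩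


/-- Lower bound: for every stabilizing assignment `p`, the
optimal dual-mode delay is at least the optimal tunable-mode delay. -/
theorem dual_mode_delay_lower_bound
    (μ0 K f1 f2 lam : ℝ)
    (hμ0 : 0 < μ0) (hK : 1 < K)
    (hf1 : 0 ≤ f1) (h12 : f1 < f2) (hf2 : f2 ≤ 1)
    (hlam0 : 0 < lam) (hlam : lam < (K + 1) * μ0)
    (f : ℝ → ℝ) (hf : f = fun p => p * f1 + (1 - p) * f2)
    (P : Set ℝ)
    (hP : P = {p ∈ Set.Icc (0 : ℝ) 1 | lam * f p < μ0 ∧ lam * (1 - f p) < K * μ0})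
    (TDM : ℝ → ℝ)
    (hTDM : TDM = fun p =>
      (Real.sqrt (p * f1) + Real.sqrt ((1 - p) * f2)) ^ 2 / (μ0 - lam * f p) +
      (Real.sqrt (p * (1 - f1)) + Real.sqrt ((1 - p) * (1 - f2))) ^ 2 /
        (K * μ0 - lam * (1 - f p)))
    (TTM : ℝ → ℝ)
    (hTTM : TTM = fun g => g / (μ0 - g * lam) + (1 - g) / (K * μ0 - (1 - g) * lam))
    (fstar : ℝ)
    (hfstar : fstar = max ((lam - μ0 * (K - Real.sqrt K)) / (lam * (1 + Real.sqrt K))) 0) :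
    ∀ p ∈ P, TTM fstar ≤ TDM p := by
  subst hf hP hTDM hTTM
  rintro p ⟨⟨hp0, hp1⟩, hx, hy⟩
  have hq : 0 ≤ 1 - p := by linarith
  have h2 : 0 ≤ f2 := hf1.trans h12.le
  have hsq : Real.sqrt K ^ 2 = K := Real.sq_sqrt (by linarith)
  have hs : 1 < Real.sqrt K := by rwa [Real.lt_sqrt zero_le_one, one_pow]
  have hA := add_le_sq_sqrt_add_sqrt (mul_nonneg hp0 hf1) (mul_nonneg hq h2)
  have hB := add_le_sq_sqrt_add_sqrt (mul_nonneg hp0 (by linarith : 0 ≤ 1 - f1))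
    (mul_nonneg hq (by linarith : 0 ≤ 1 - f2))
  have hB' : p * (1 - f1) + (1 - p) * (1 - f2) = 1 - (p * f1 + (1 - p) * f2) := by ring
  rw [hB'] at hB
  have hg : 0 ≤ p * f1 + (1 - p) * f2 := by positivity
  beta_reduce at hx hy ⊢
  rw [mul_comm lam] at hx hy
  rw [mul_comm lam, mul_comm lam]
  generalize p * f1 + (1 - p) * f2 = g at *
  have hmin := tunable_delay_min (s := Real.sqrt K) (c := fstar) hμ0 hs hlam0
    hg (sub_pos.2 hx) (by rw [hsq]; exact sub_pos.2 hy) (by rw [hsq]; exact hfstar)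
  rw [hsq] at hmin
  exact hmin.trans (add_le_add (div_le_div_of_nonneg_right hA (sub_pos.2 hx).le)
    (div_le_div_of_nonneg_right hB (sub_pos.2 hy).le))
end

section
/- (Redundant mode) Let μ0 > 0, K > 1, and canonical parameters f1, f2 with 1/(K+1) ≤ f1 < f2 ≤ 1, and let λ > 0. Then for every p ∈ P_λ, the assignment p = 1 also belongs to P_λ and T*_DM(1;λ) ≤ T*_DM(p;λ); that is, exclusive assignment to the cloud-heavy Service Mode 1 is delay-optimal. -/
/-- The total delay of two parallel queues of capacities `μ` and `K * μ` is monotone in the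
fraction `x` of the load sent to the slower one, as long as `1 - x ≤ K * x`. -/
theorem two_queue_delay_mono {μ K l x y : ℝ} (hμ : 0 < μ) (hK : 1 < K) (hl : 0 < l)
    (hx : 1 - x ≤ K * x) (hxy : x ≤ y) (hy : l * y < μ) :
    x / (μ - l * x) + (1 - x) / (K * μ - l * (1 - x)) ≤
      y / (μ - l * y) + (1 - y) / (K * μ - l * (1 - y)) := by
  have hK0 : 0 < K := by linarith
  have hlxy : l * x ≤ l * y := mul_le_mul_of_nonneg_left hxy hl.le
  have hax : 0 < μ - l * x := by linarith
  have hay : 0 < μ - l * y := by linarith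
  have hbx : K * (μ - l * x) ≤ K * μ - l * (1 - x) := by
    nlinarith [mul_le_mul_of_nonneg_left hx hl.le]
  have hy' : 1 - y ≤ K * y := by nlinarith
  have hby : K * (μ - l * y) ≤ K * μ - l * (1 - y) := by
    nlinarith [mul_le_mul_of_nonneg_left hy' hl.le]
  have hbx0 : 0 < K * μ - l * (1 - x) := (mul_pos hK0 hax).trans_le hbx
  have hby0 : 0 < K * μ - l * (1 - y) := (mul_pos hK0 hay).trans_le hby
  have e1 : y / (μ - l * y) - x / (μ - l * x) =
      μ * (y - x) / ((μ - l * y) * (μ - l * x)) := by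
    rw [div_sub_div _ _ hay.ne' hax.ne']
    ring
  have e2 : (1 - x) / (K * μ - l * (1 - x)) - (1 - y) / (K * μ - l * (1 - y)) =
      K * (μ * (y - x)) / ((K * μ - l * (1 - x)) * (K * μ - l * (1 - y))) := by
    rw [div_sub_div _ _ hbx0.ne' hby0.ne']
    ring
  have hprod : K * ((μ - l * y) * (μ - l * x)) ≤
      (K * μ - l * (1 - x)) * (K * μ - l * (1 - y)) := by
    have h := mul_le_mul hbx hby (mul_pos hK0 hay).le hbx0.le
    nlinarith [mul_pos hK0 (mul_pos hay hax)]
  have hle : K * (μ * (y - x)) / ((K * μ - l * (1 - x)) * (K * μ - l * (1 - y))) ≤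
      μ * (y - x) / ((μ - l * y) * (μ - l * x)) := by
    rw [div_le_div_iff₀ (mul_pos hbx0 hby0) (mul_pos hay hax)]
    have h := mul_le_mul_of_nonneg_left hprod (mul_nonneg hμ.le (sub_nonneg.2 hxy))
    linarith
  linarith

/-- Redundant mode: if `1/(K+1) ≤ f1`, exclusive assignment to
Service Mode 1 (`p = 1`) is stabilizing and delay-optimal. -/
theorem redundant_mode
    (μ0 K f1 f2 lam : ℝ)
    (hμ0 : 0 < μ0) (hK : 1 < K)
    (hf1 : 1 / (K + 1) ≤ f1) (h12 : f1 < f2) (hf2 : f2 ≤ 1)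
    (hlam : 0 < lam)
    (f : ℝ → ℝ) (hf : f = fun p => p * f1 + (1 - p) * f2)
    (P : Set ℝ)
    (hP : P = {p ∈ Set.Icc (0 : ℝ) 1 | lam * f p < μ0 ∧ lam * (1 - f p) < K * μ0})
    (TDM : ℝ → ℝ)
    (hTDM : TDM = fun p =>
      (Real.sqrt (p * f1) + Real.sqrt ((1 - p) * f2)) ^ 2 / (μ0 - lam * f p) +
      (Real.sqrt (p * (1 - f1)) + Real.sqrt ((1 - p) * (1 - f2))) ^ 2 /
        (K * μ0 - lam * (1 - f p))) :
    ∀ p ∈ P, (1 : ℝ) ∈ P ∧ TDM 1 ≤ TDM p := by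
  subst hf hP hTDM
  rintro p ⟨⟨hp0, hp1⟩, hloc, hcloud⟩
  dsimp only at hloc hcloud ⊢
  have hq : 0 ≤ 1 - p := by linarith
  have hx : 1 - f1 ≤ K * f1 := by
    rw [div_le_iff₀ (by linarith)] at hf1
    linarith
  have hf1pos : 0 < f1 := lt_of_lt_of_le (by positivity) hf1
  have hxy : f1 ≤ p * f1 + (1 - p) * f2 := by nlinarith
  have hloc1 : lam * f1 < μ0 := (mul_le_mul_of_nonneg_left hxy hlam.le).trans_lt hloc
  have hcloud1 : lam * (1 - f1) < K * μ0 := by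
    nlinarith [mul_le_mul_of_nonneg_left hx hlam.le]
  refine ⟨⟨⟨zero_le_one, le_rfl⟩, by simpa using hloc1, by simpa using hcloud1⟩, ?_⟩
  simp only [one_mul, sub_self, zero_mul, Real.sqrt_zero, add_zero]
  rw [Real.sq_sqrt hf1pos.le, Real.sq_sqrt (by linarith : 0 ≤ 1 - f1)]
  refine (two_queue_delay_mono hμ0 hK hlam hx hxy hloc).trans ?_
  have hnum1 := add_le_sq_sqrt_add_sqrt (mul_nonneg hp0 hf1pos.le)
    (mul_nonneg hq (hf1pos.trans h12).le)
  have hnum2 := add_le_sq_sqrt_add_sqrt (mul_nonneg hp0 (by linarith : 0 ≤ 1 - f1))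
    (mul_nonneg hq (sub_nonneg.2 hf2))
  exact add_le_add (div_le_div_of_nonneg_right hnum1 (by linarith))
    (div_le_div_of_nonneg_right (by linarith) (by linarith))
end

section
/- (SM1 optimality at low loads) Let μ0 > 0, K > 1, and canonical parameters f1, f2 with 0 ≤ f1 < f2 ≤ 1 and f1 < 1/(K+1). Let λ > 0 satisfy λ·f1 < μ0, λ·(1−f2) < K·μ0, λ < (K+1)·μ0, and λ ≤ μ0·(K − √K)/(1 − f1·(1 + √K)). Then p = 1 belongs to P_λ and T*_DM(1;λ) ≤ T*_DM(p;λ) for every p ∈ P_λ. -/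
theorem add_le_sq_sqrt_add_sqrt_s14 {x y : ℝ} (hx : 0 ≤ x) (hy : 0 ≤ y) :
    x + y ≤ (Real.sqrt x + Real.sqrt y) ^ 2 := by
  have := Real.sq_sqrt hx
  have := Real.sq_sqrt hy
  nlinarith [mul_nonneg (Real.sqrt_nonneg x) (Real.sqrt_nonneg y)]

/-- The total delay of two queues with rates `μ` and `K * μ` sharing the load `lam` does not decrease
when the fraction sent to the slow one grows from `x` to `y`, provided that at `x` the residual
capacities differ by a factor of at least `√K`. -/
theorem delay_le_delay_of_sqrt_mul_le {μ K lam x y : ℝ} (hμ : 0 < μ) (hK : 0 ≤ K)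
    (hlam : 0 ≤ lam) (hxy : x ≤ y) (hy : 0 < μ - lam * y) (hx : 0 < K * μ - lam * (1 - x))
    (h : Real.sqrt K * (μ - lam * x) ≤ K * μ - lam * (1 - x)) :
    x / (μ - lam * x) + (1 - x) / (K * μ - lam * (1 - x)) ≤
      y / (μ - lam * y) + (1 - y) / (K * μ - lam * (1 - y)) := by
  have hshift : 0 ≤ lam * (y - x) := mul_nonneg hlam (sub_nonneg.2 hxy)
  have hx' : 0 < μ - lam * x := by linarith
  have hy' : 0 < K * μ - lam * (1 - y) := by linarith
  have hle : Real.sqrt K * (μ - lam * y) ≤ K * μ - lam * (1 - y) := by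
    have := mul_le_mul_of_nonneg_left
      (show μ - lam * y ≤ μ - lam * x by linarith) (Real.sqrt_nonneg K)
    linarith
  have hprod : K * ((μ - lam * x) * (μ - lam * y)) ≤
      (K * μ - lam * (1 - x)) * (K * μ - lam * (1 - y)) :=
    calc K * ((μ - lam * x) * (μ - lam * y))
        = (Real.sqrt K * (μ - lam * x)) * (Real.sqrt K * (μ - lam * y)) := by
          linear_combination -((μ - lam * x) * (μ - lam * y)) * Real.sq_sqrt hK
      _ ≤ _ := mul_le_mul h hle (mul_nonneg (Real.sqrt_nonneg K) hy.le) hx.le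
  have hslow : y / (μ - lam * y) - x / (μ - lam * x) =
      μ * (y - x) / ((μ - lam * x) * (μ - lam * y)) := by
    rw [div_sub_div _ _ hy.ne' hx'.ne', mul_comm (μ - lam * x)]
    congr 1
    ring
  have hfast : (1 - x) / (K * μ - lam * (1 - x)) - (1 - y) / (K * μ - lam * (1 - y)) =
      μ * (y - x) * K / ((K * μ - lam * (1 - x)) * (K * μ - lam * (1 - y))) := by
    rw [div_sub_div _ _ hx.ne' hy'.ne']
    congr 1
    ring
  have hcmp : μ * (y - x) * K / ((K * μ - lam * (1 - x)) * (K * μ - lam * (1 - y))) ≤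
      μ * (y - x) / ((μ - lam * x) * (μ - lam * y)) := by
    rw [div_le_div_iff₀ (mul_pos hx hy') (mul_pos hx' hy), mul_assoc]
    exact mul_le_mul_of_nonneg_left hprod (mul_nonneg hμ.le (sub_nonneg.2 hxy))
  linarith


/-- SM1 optimality at low loads: if `f1 < 1/(K+1)` and the load
is at most the breakaway threshold, then `p = 1` is stabilizing and optimal. -/
theorem sm1_optimal_low_load
    (μ0 K f1 f2 lam : ℝ)
    (hμ0 : 0 < μ0) (hK : 1 < K)
    (hf10 : 0 ≤ f1) (h12 : f1 < f2) (hf2 : f2 ≤ 1)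
    (hf1 : f1 < 1 / (K + 1))
    (hlam0 : 0 < lam)
    (hstab1 : lam * f1 < μ0) (hstab2 : lam * (1 - f2) < K * μ0)
    (hstab3 : lam < (K + 1) * μ0)
    (hlow : lam ≤ μ0 * (K - Real.sqrt K) / (1 - f1 * (1 + Real.sqrt K)))
    (f : ℝ → ℝ) (hf : f = fun p => p * f1 + (1 - p) * f2)
    (P : Set ℝ)
    (hP : P = {p ∈ Set.Icc (0 : ℝ) 1 | lam * f p < μ0 ∧ lam * (1 - f p) < K * μ0})
    (TDM : ℝ → ℝ)
    (hTDM : TDM = fun p =>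
      (Real.sqrt (p * f1) + Real.sqrt ((1 - p) * f2)) ^ 2 / (μ0 - lam * f p) +
      (Real.sqrt (p * (1 - f1)) + Real.sqrt ((1 - p) * (1 - f2))) ^ 2 /
        (K * μ0 - lam * (1 - f p))) :
    (1 : ℝ) ∈ P ∧ ∀ p ∈ P, TDM 1 ≤ TDM p := by
  subst hf hP hTDM
  have hsq : Real.sqrt K ^ 2 = K := Real.sq_sqrt (by linarith)
  have hsK : Real.sqrt K < K := by
    nlinarith [Real.lt_sqrt zero_le_one |>.2 (by simpa using hK)]
  have hden : 0 < 1 - f1 * (1 + Real.sqrt K) := by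
    rw [lt_div_iff₀ (by linarith)] at hf1
    nlinarith
  rw [le_div_iff₀ hden] at hlow
  have hbal : Real.sqrt K * (μ0 - lam * f1) ≤ K * μ0 - lam * (1 - f1) := by linarith
  have hpos : 0 < K * μ0 - lam * (1 - f1) :=
    (mul_pos (Real.sqrt_pos.2 (by linarith)) (sub_pos.2 hstab1)).trans_le hbal
  refine ⟨⟨by simp, by simpa using hstab1, by simpa using hpos⟩, ?_⟩
  rintro p ⟨⟨hp0, hp1⟩, hslow, hfast⟩
  dsimp only at hslow hfast ⊢
  have hq : 0 ≤ 1 - p := sub_nonneg.2 hp1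
  have hle : f1 ≤ p * f1 + (1 - p) * f2 := by nlinarith
  have hlocal := add_le_sq_sqrt_add_sqrt_s14 (mul_nonneg hp0 hf10)
    (mul_nonneg hq (hf10.trans h12.le))
  have hremote : 1 - (p * f1 + (1 - p) * f2) ≤ _ := le_trans (le_of_eq (by ring)) <|
    add_le_sq_sqrt_add_sqrt_s14 (mul_nonneg hp0 (sub_nonneg.2 (h12.le.trans hf2)))
      (mul_nonneg hq (sub_nonneg.2 hf2))
  have hone : ∀ x : ℝ, 0 ≤ x → ∀ y : ℝ,
      (Real.sqrt (1 * x) + Real.sqrt ((1 - 1) * y)) ^ 2 = x := by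
    intro x hx y
    simp [Real.sq_sqrt hx]
  rw [hone f1 hf10, hone (1 - f1) (by linarith),
    show 1 * f1 + (1 - 1) * f2 = f1 by ring]
  exact (delay_le_delay_of_sqrt_mul_le hμ0 (by linarith) hlam0.le hle (sub_pos.2 hslow) hpos
    hbal).trans (add_le_add (div_le_div_of_nonneg_right hlocal (sub_pos.2 hslow).le)
      (div_le_div_of_nonneg_right hremote (sub_pos.2 hfast).le))
end

section
/- (Breakaway from SM1 at high loads) Let μ0 > 0, K > 1, and canonical parameters f1, f2 with 0 ≤ f1 < f2 ≤ 1 and f1 < 1/(K+1). Let λ > 0 satisfy λ·f1 < μ0, λ·(1−f2) < K·μ0, λ < (K+1)·μ0, and λ ≥ K·μ0/(1 − f1). Then P_λ is nonempty and every p ∈ P_λ satisfies p < 1; in particular any delay-optimal assignment parameter lies in [0,1). -/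
/-- Breakaway from SM1 at high loads: if `f1 < 1/(K+1)` and
`λ ≥ K·μ0/(1−f1)`, then the set of stabilizing assignments is nonempty and
excludes `p = 1`. -/
theorem breakaway_high_load
    (μ0 K f1 f2 lam : ℝ)
    (hμ0 : 0 < μ0) (hK : 1 < K)
    (hf10 : 0 ≤ f1) (h12 : f1 < f2) (hf2 : f2 ≤ 1)
    (hf1 : f1 < 1 / (K + 1))
    (hlam0 : 0 < lam)
    (hstab1 : lam * f1 < μ0) (hstab2 : lam * (1 - f2) < K * μ0)
    (hstab3 : lam < (K + 1) * μ0)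
    (hhigh : K * μ0 / (1 - f1) ≤ lam)
    (f : ℝ → ℝ) (hf : f = fun p => p * f1 + (1 - p) * f2)
    (P : Set ℝ)
    (hP : P = {p ∈ Set.Icc (0 : ℝ) 1 | lam * f p < μ0 ∧ lam * (1 - f p) < K * μ0}) :
    P.Nonempty ∧ ∀ p ∈ P, p < 1 := by
  have hKlam : K * μ0 ≤ lam * (1 - f1) := (div_le_iff₀ (by linarith)).mp hhigh
  subst hf hP
  constructor
  · have hlo : f1 ≤ 1 - K * μ0 / lam := by
      have : K * μ0 / lam ≤ 1 - f1 := (div_le_iff₀ hlam0).mpr (by linarith)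
      linarith
    have hlt : 1 - K * μ0 / lam < min (μ0 / lam) f2 := by
      refine lt_min ?_ ?_
      · have : 1 < (K + 1) * μ0 / lam := (one_lt_div hlam0).mpr hstab3
        rw [add_mul, one_mul, add_div] at this
        linarith
      · have : 1 - f2 < K * μ0 / lam := (lt_div_iff₀ hlam0).mpr (by linarith)
        linarith
    obtain ⟨x, hx1, hx2⟩ := exists_between hlt
    obtain ⟨hxμ, hxf⟩ := lt_min_iff.mp hx2
    have hd : 0 < f2 - f1 := sub_pos.mpr h12
    have hfx : (f2 - x) / (f2 - f1) * f1 + (1 - (f2 - x) / (f2 - f1)) * f2 = x := by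
      field_simp
      ring
    refine ⟨(f2 - x) / (f2 - f1), ⟨div_nonneg (by linarith) hd.le,
      (div_le_one hd).mpr (by linarith)⟩, ?_, ?_⟩
    · simp only [hfx]
      linarith [(lt_div_iff₀ hlam0).mp hxμ]
    · simp only [hfx]
      have : 1 - x < K * μ0 / lam := by linarith
      linarith [(lt_div_iff₀ hlam0).mp this]
  · rintro p ⟨⟨-, hp1⟩, -, hp⟩
    refine lt_of_le_of_ne hp1 ?_
    rintro rfl
    simp only [one_mul, sub_self, zero_mul, add_zero] at hp
    linarith
end

section
/- (Both modes needed at high loads) Let μ0 > 0, K > 1, and canonical parameters f1, f2 be throughput-efficient, i.e. 0 ≤ f1 < 1/(K+1) < f2 ≤ 1. Let λ satisfy max{μ0/f2, K·μ0/(1−f1)} < λ < (K+1)·μ0. Then P_λ is nonempty and every p ∈ P_λ satisfies 0 < p < 1; in particular any delay-optimal assignment parameter lies in the open interval (0,1). -/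
/-- Both modes needed at high loads: for a throughput-efficient
system at high loads, every stabilizing assignment lies strictly in `(0,1)`. -/
theorem both_modes_needed
    (μ0 K f1 f2 lam : ℝ)
    (hμ0 : 0 < μ0) (hK : 1 < K)
    (hf10 : 0 ≤ f1) (hf1 : f1 < 1 / (K + 1)) (hf2 : 1 / (K + 1) < f2) (hf21 : f2 ≤ 1)
    (hlow : max (μ0 / f2) (K * μ0 / (1 - f1)) < lam)
    (hhigh : lam < (K + 1) * μ0)
    (f : ℝ → ℝ) (hf : f = fun p => p * f1 + (1 - p) * f2)
    (P : Set ℝ)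
    (hP : P = {p ∈ Set.Icc (0 : ℝ) 1 | lam * f p < μ0 ∧ lam * (1 - f p) < K * μ0}) :
    P.Nonempty ∧ ∀ p ∈ P, 0 < p ∧ p < 1 := by
  have hK1 : 0 < K + 1 := by linarith
  have hc : 0 < 1 / (K + 1) := by positivity
  have hcK : 1 / (K + 1) * (K + 1) = 1 := by field_simp
  set c := 1 / (K + 1)
  have hc1 : c < 1 := by linarith
  obtain ⟨hlow1, hlow2⟩ := max_lt_iff.mp hlow
  rw [div_lt_iff₀ (by linarith)] at hlow1 hlow2
  subst hf hP
  have hd : 0 < f2 - f1 := by linarith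
  refine ⟨⟨(f2 - c) / (f2 - f1), ⟨?_, ?_⟩, ?_⟩, ?_⟩
  · exact div_nonneg (by linarith) hd.le
  · rw [div_le_one hd]
    linarith
  · have hfp : (f2 - c) / (f2 - f1) * f1 + (1 - (f2 - c) / (f2 - f1)) * f2 = c := by
      have h := hd.ne'
      field_simp
      ring
    have hlc : lam * c < μ0 := by
      calc lam * c < (K + 1) * μ0 * c := mul_lt_mul_of_pos_right hhigh hc
        _ = c * (K + 1) * μ0 := by ring
        _ = μ0 := by rw [hcK, one_mul]
    have hc' : 1 - c = K * c := by linarith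
    simp only [hfp]
    refine ⟨hlc, ?_⟩
    rw [hc', mul_left_comm]
    exact mul_lt_mul_of_pos_left hlc (by linarith)
  · rintro p ⟨⟨hp0, hp1⟩, h1, h2⟩
    refine ⟨hp0.lt_of_ne ?_, hp1.lt_of_ne ?_⟩
    · rintro rfl
      norm_num at h1
      linarith
    · rintro rfl
      norm_num at h2
      linarith
end

section
/- (SM2 optimality at high loads) Let μ0 > 0, K > 1, and canonical parameters f1, f2 with 0 ≤ f1 < f2 ≤ 1 and f2 ≤ 1/(K+1). Let λ > 0 satisfy λ·f1 < μ0, λ·(1−f2) < K·μ0, λ < (K+1)·μ0, and λ ≥ μ0·(K − √K)/(1 − f2·(1 + √K)). Then p = 0 belongs to P_λ and T*_DM(0;λ) ≤ T*_DM(p;λ) for every p ∈ P_λ; that is, exclusive assignment to the local-heavy Service Mode 2 is delay-optimal. -/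
/-- The total weighted delay of two parallel queues with service rates `m` and `K * m` does not
decrease when the fraction routed to the first one drops from `y` to `x`, provided that its
residual capacity at `y`, scaled by `√K`, is at least that of the second one. -/
theorem parallel_delay_le {m K l x y : ℝ} (hm : 0 < m) (hK : 0 < K) (hl : 0 < l) (hxy : x ≤ y)
    (hA : 0 < m - l * y) (hb : 0 < K * m - l * (1 - x))
    (hB : K * m - l * (1 - y) ≤ Real.sqrt K * (m - l * y)) :
    y / (m - l * y) + (1 - y) / (K * m - l * (1 - y)) ≤
      x / (m - l * x) + (1 - x) / (K * m - l * (1 - x)) := by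
  have hlxy : l * x ≤ l * y := mul_le_mul_of_nonneg_left hxy hl.le
  have ha : 0 < m - l * x := by linarith
  have hB0 : 0 < K * m - l * (1 - y) := by linarith
  have hs := Real.sqrt_nonneg K
  have hb' : K * m - l * (1 - x) ≤ Real.sqrt K * (m - l * x) := by
    have := mul_le_mul_of_nonneg_left hlxy hs
    linarith
  have key : (K * m - l * (1 - x)) * (K * m - l * (1 - y)) ≤
      K * ((m - l * x) * (m - l * y)) := by
    calc _ ≤ (Real.sqrt K * (m - l * x)) * (Real.sqrt K * (m - l * y)) :=
          mul_le_mul hb' hB hB0.le (by positivity)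
      _ = Real.sqrt K ^ 2 * ((m - l * x) * (m - l * y)) := by ring
      _ = _ := by rw [Real.sq_sqrt hK.le]
  have e1 : y / (m - l * y) - x / (m - l * x) =
      m * (y - x) / ((m - l * x) * (m - l * y)) := by
    rw [div_sub_div _ _ hA.ne' ha.ne']
    congr 1 <;> ring
  have e2 : (1 - x) / (K * m - l * (1 - x)) - (1 - y) / (K * m - l * (1 - y)) =
      K * m * (y - x) / ((K * m - l * (1 - x)) * (K * m - l * (1 - y))) := by
    rw [div_sub_div _ _ hb.ne' hB0.ne']
    congr 1
    ring
  have e3 : m * (y - x) / ((m - l * x) * (m - l * y)) ≤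
      K * m * (y - x) / ((K * m - l * (1 - x)) * (K * m - l * (1 - y))) := by
    rw [div_le_div_iff₀ (mul_pos ha hA) (mul_pos hb hB0)]
    have := mul_le_mul_of_nonneg_left key (mul_nonneg hm.le (sub_nonneg.2 hxy))
    linarith
  linarith


/-- SM2 optimality at high loads: if `f2 ≤ 1/(K+1)` and the load
is high enough, exclusive assignment to Service Mode 2 (`p = 0`) is
stabilizing and delay-optimal. -/
theorem sm2_optimal_high_load
    (μ0 K f1 f2 lam : ℝ)
    (hμ0 : 0 < μ0) (hK : 1 < K)
    (hf10 : 0 ≤ f1) (h12 : f1 < f2) (hf21 : f2 ≤ 1)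
    (hf2 : f2 ≤ 1 / (K + 1))
    (hlam0 : 0 < lam)
    (hstab1 : lam * f1 < μ0) (hstab2 : lam * (1 - f2) < K * μ0)
    (hstab3 : lam < (K + 1) * μ0)
    (hhigh : μ0 * (K - Real.sqrt K) / (1 - f2 * (1 + Real.sqrt K)) ≤ lam)
    (f : ℝ → ℝ) (hf : f = fun p => p * f1 + (1 - p) * f2)
    (P : Set ℝ)
    (hP : P = {p ∈ Set.Icc (0 : ℝ) 1 | lam * f p < μ0 ∧ lam * (1 - f p) < K * μ0})
    (TDM : ℝ → ℝ)
    (hTDM : TDM = fun p =>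
      (Real.sqrt (p * f1) + Real.sqrt ((1 - p) * f2)) ^ 2 / (μ0 - lam * f p) +
      (Real.sqrt (p * (1 - f1)) + Real.sqrt ((1 - p) * (1 - f2))) ^ 2 /
        (K * μ0 - lam * (1 - f p))) :
    (0 : ℝ) ∈ P ∧ ∀ p ∈ P, TDM 0 ≤ TDM p := by
  subst hf hP hTDM
  have hK0 : 0 < K := by linarith
  have hs1 : 1 < Real.sqrt K := by rwa [Real.lt_sqrt zero_le_one, one_pow]
  have hs2 : Real.sqrt K ^ 2 = K := Real.sq_sqrt hK0.le
  have hf2' : f2 * (K + 1) ≤ 1 := (le_div_iff₀ (by linarith)).1 hf2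
  have hf20 : 0 < f2 := by linarith
  have hden : 0 < 1 - f2 * (1 + Real.sqrt K) := by
    have : Real.sqrt K < K := by nlinarith
    nlinarith [mul_lt_mul_of_pos_left this hf20]
  have hhigh' := (div_le_iff₀ hden).1 hhigh
  have hA : 0 < μ0 - lam * f2 := by
    have h1 : f2 * lam < f2 * ((K + 1) * μ0) := mul_lt_mul_of_pos_left hstab3 hf20
    have h2 := mul_le_mul_of_nonneg_right hf2' hμ0.le
    linarith
  refine ⟨⟨by simp, by simpa using hA, by simpa using hstab2⟩, ?_⟩
  rintro p ⟨⟨hp0, hp1⟩, hpa, hpb⟩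
  have hq : 0 ≤ 1 - p := by linarith
  have hle : p * f1 + (1 - p) * f2 ≤ f2 := by
    nlinarith [mul_le_mul_of_nonneg_left h12.le hp0]
  have hzero : 0 ≤ 1 - f2 := by linarith
  have h1 := add_le_sq_sqrt_add_sqrt (mul_nonneg hp0 hf10) (mul_nonneg hq hf20.le)
  have h2 := add_le_sq_sqrt_add_sqrt (mul_nonneg hp0 (by linarith : 0 ≤ 1 - f1))
    (mul_nonneg hq hzero)
  have h3 : p * (1 - f1) + (1 - p) * (1 - f2) = 1 - (p * f1 + (1 - p) * f2) := by ring
  rw [h3] at h2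
  have hmain := parallel_delay_le hμ0 hK0 hlam0 hle hA (sub_pos.2 hpb) (by linarith)
  simp only [zero_mul, sub_zero, one_mul, zero_add, Real.sqrt_zero, Real.sq_sqrt hf20.le,
    Real.sq_sqrt hzero]
  exact hmain.trans (add_le_add (div_le_div_of_nonneg_right h1 (sub_pos.2 hpa).le)
    (div_le_div_of_nonneg_right h2 (sub_pos.2 hpb).le))
end
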